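/- arXiv:1403.0667 — 12 statements merged into one kernel-verified Lean document; each statement's English description precedes it below -/
import Mathlib

section
/- Let g : [0,∞) → ℝ be continuous on [0,∞) and twice continuously differentiable on (0,∞), and suppose that the function x ↦ g(√x) is NOT strictly convex on [0,∞). Then there exist an integer m > 1 and strictly positive real numbers α₁,…,α_m and β₁,…,β_m such that the function F_g(u) = Σ_{i=1}^m α_i · g(β_i · |u_i|) has a local maximum relative to the unit sphere S^{m−1} that is not contained in the set {±e_i : 1 ≤ i ≤ m} of signed canonical basis vectors. -/
open Filter Set Metric

noncomputable section

/-- A continuous function on a convex set `s` of reals that is not strictly convex lies, on some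
segment of `s`, below a line that touches it from above at an interior point of the segment. -/
theorem exists_interior_le_line_of_not_strictConvexOn {s : Set ℝ} (hs : Convex ℝ s) {h : ℝ → ℝ}
    (hc : ContinuousOn h s) (hn : ¬ StrictConvexOn ℝ s h) :
    ∃ x ∈ s, ∃ y ∈ s, ∃ z ∈ Ioo x y, ∃ c : ℝ,
      ∀ t ∈ Icc x y, h t - c * t ≤ h z - c * z := by
  have hlt : ∃ x ∈ s, ∃ y ∈ s, x < y ∧ ∃ a b : ℝ, 0 < a ∧ 0 < b ∧ a + b = 1 ∧
      a * h x + b * h y ≤ h (a * x + b * y) := by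
    by_contra hcon
    push Not at hcon
    refine hn ⟨hs, fun x hx y hy hxy a b ha hb hab => ?_⟩
    simp only [smul_eq_mul]
    rcases lt_or_gt_of_ne hxy with hl | hl
    · exact hcon x hx y hy hl a b ha hb hab
    · have := hcon y hy x hx hl b a hb ha (by linarith)
      rwa [add_comm (b * y), add_comm (b * h y)] at this
  obtain ⟨x, hx, y, hy, hxy, a, b, ha, hb, hab, hz⟩ := hlt
  obtain ⟨c, hcs⟩ : ∃ c : ℝ, h y - c * y = h x - c * x := by
    have : y - x ≠ 0 := by linarith
    exact ⟨(h y - h x) / (y - x), by field_simp; ring⟩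
  have hsub : Icc x y ⊆ s := hs.ordConnected.out hx hy
  obtain ⟨w, hw, hmax⟩ := isCompact_Icc.exists_isMaxOn (nonempty_Icc.2 hxy.le)
    (f := fun t => h t - c * t) ((hc.mono hsub).sub (by fun_prop))
  have hmax' : ∀ t ∈ Icc x y, h t - c * t ≤ h w - c * w := fun t ht => hmax ht
  by_cases hwi : w ∈ Ioo x y
  · exact ⟨x, hx, y, hy, w, hwi, c, hmax'⟩
  · have hwx : h w - c * w = h x - c * x := by
      rcases eq_endpoints_or_mem_Ioo_of_mem_Icc hw with rfl | rfl | hi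
      · rfl
      · exact hcs
      · exact absurd hi hwi
    obtain rfl : a = 1 - b := by linarith
    refine ⟨x, hx, y, hy, (1 - b) * x + b * y, ⟨by nlinarith, by nlinarith⟩, c, fun t ht => ?_⟩
    have := hmax' t ht
    linear_combination this + hz + hwx - b * hcs

theorem statement1 (g : ℝ → ℝ)
    (hg_cont : ContinuousOn g (Set.Ici 0))
    (hg_smooth : ContDiffOn ℝ 2 g (Set.Ioi 0))
    (hnconv : ¬ StrictConvexOn ℝ (Set.Ici 0) (fun x => g (Real.sqrt x))) :
    ∃ m : ℕ, 1 < m ∧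
      ∃ α β : Fin m → ℝ, (∀ i, 0 < α i) ∧ (∀ i, 0 < β i) ∧
        ∃ u ∈ sphere (0 : EuclideanSpace ℝ (Fin m)) 1,
          IsLocalMaxOn (fun u : EuclideanSpace ℝ (Fin m) => ∑ i, α i * g (β i * |u i|))
            (sphere (0 : EuclideanSpace ℝ (Fin m)) 1) u ∧
          ∀ i : Fin m, u ≠ EuclideanSpace.single i 1 ∧ u ≠ -EuclideanSpace.single i 1 := by
  have hcont : ContinuousOn (fun x => g (Real.sqrt x)) (Ici 0) :=
    hg_cont.comp Real.continuous_sqrt.continuousOn fun x _ => Real.sqrt_nonneg x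
  obtain ⟨x, hx, y, -, z, hz, c, hmax⟩ :=
    exists_interior_le_line_of_not_strictConvexOn (convex_Ici 0) hcont hnconv
  have hz0 : 0 < z := lt_of_le_of_lt hx hz.1
  have hg (r : ℝ) : g (√(2 * z) * |r|) = g √(2 * z * r ^ 2) := by
    rw [Real.sqrt_mul (x := 2 * z) (by positivity), Real.sqrt_sq_eq_abs]
  have hhalf : √(1 / 2 : ℝ) ^ 2 = 1 / 2 := Real.sq_sqrt (by norm_num)
  have hpos : 0 < √(1 / 2 : ℝ) := by positivity
  have hsphere (v : EuclideanSpace ℝ (Fin 2)) :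
      v ∈ sphere (0 : EuclideanSpace ℝ (Fin 2)) 1 ↔ v 0 ^ 2 + v 1 ^ 2 = 1 := by
    rw [mem_sphere_zero_iff_norm, ← sq_eq_sq₀ (norm_nonneg v) zero_le_one,
      EuclideanSpace.real_norm_sq_eq, Fin.sum_univ_two, one_pow]
  refine ⟨2, one_lt_two, fun _ => 1, fun _ => √(2 * z), fun _ => one_pos,
    fun _ => by positivity, !₂[√(1 / 2), √(1 / 2)], ?_, ?_, ?_⟩
  · rw [hsphere]
    simp only [Matrix.cons_val_zero, Matrix.cons_val_one]
    linarith
  · have hnear (i : Fin 2) : ∀ᶠ v : EuclideanSpace ℝ (Fin 2) in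
        nhds !₂[√(1 / 2), √(1 / 2)], 2 * z * v i ^ 2 ∈ Ioo x y := by
      have hcv : Continuous fun v : EuclideanSpace ℝ (Fin 2) => 2 * z * v i ^ 2 := by fun_prop
      refine hcv.continuousAt.eventually_mem (isOpen_Ioo.mem_nhds ?_)
      have : (!₂[√(1 / 2), √(1 / 2)] : EuclideanSpace ℝ (Fin 2)) i = √(1 / 2) := by
        fin_cases i <;> rfl
      rw [this, hhalf]
      convert hz using 1
      ring
    filter_upwards [self_mem_nhdsWithin, nhdsWithin_le_nhds (hnear 0),
      nhdsWithin_le_nhds (hnear 1)] with v hv h0 h1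
    rw [hsphere] at hv
    have e : 2 * z * (1 / 2) = z := by ring
    simp only [hg, Fin.sum_univ_two, one_mul, Matrix.cons_val_zero,
      Matrix.cons_val_one, hhalf, e]
    have k0 := hmax _ (Ioo_subset_Icc_self h0)
    have k1 := hmax _ (Ioo_subset_Icc_self h1)
    linear_combination k0 + k1 + 2 * z * c * hv
  · intro i
    have hne : ∀ j : Fin 2, (!₂[√(1 / 2), √(1 / 2)] : EuclideanSpace ℝ (Fin 2)) j ≠ 0 := by
      intro j
      fin_cases j <;> exact hpos.ne'
    have hi : i + 1 ≠ i := by fin_cases i <;> decide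
    constructor <;> intro h <;> apply hne (i + 1) <;> rw [h] <;> simp [hi]
end
end

section
/- Let g : [0,∞) → ℝ be continuous on [0,∞) and twice continuously differentiable on (0,∞) such that x ↦ g(√x) is strictly convex on [0,∞) but the right derivative of x ↦ g(√x) at 0 is finite and nonzero (i.e., property P2 fails). Then for every integer m ≥ 2 there exist strictly positive real numbers α₁,…,α_m and β₁,…,β_m such that the canonical direction e₁ is not a local maximum, relative to the unit sphere S^{m−1}, of the function F_g(u) = Σ_{i=1}^m α_i · g(β_i · |u_i|). -/
open Filter Set Metric

noncomputable section

/-- A function with positive right derivative at `0` exceeds its value at `0` immediately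
to the right of `0`. -/
theorem eventually_gt_of_hasDerivWithinAt_Ioi_pos {f : ℝ → ℝ} {D : ℝ}
    (hf : HasDerivWithinAt f D (Ioi 0) 0) (hD : 0 < D) :
    ∀ᶠ t in nhdsWithin (0 : ℝ) (Ioi 0), f 0 < f t := by
  rw [hasDerivWithinAt_iff_tendsto_slope' (by simp)] at hf
  filter_upwards [hf.eventually (lt_mem_nhds hD), self_mem_nhdsWithin] with t ht (ht0 : 0 < t)
  rw [slope_def_field, sub_zero] at ht
  linarith [(div_pos_iff_of_pos_right ht0).mp ht]

/-- If `h` is differentiable on `(0, ∞)` with nonzero right derivative `L` at `0`, there are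
`a, b > 0` with `b * h' b < a * L`. -/
theorem exists_pos_mul_deriv_lt {h : ℝ → ℝ} {L : ℝ} (hc : ContinuousOn h (Ici 0))
    (hd : ∀ x, 0 < x → DifferentiableAt ℝ h x) (hL : L ≠ 0)
    (h0 : HasDerivWithinAt h L (Ioi 0) 0) :
    ∃ a b : ℝ, 0 < a ∧ 0 < b ∧ b * deriv h b < a * L := by
  rcases hL.lt_or_gt with hneg | hpos
  · obtain ⟨x, hx, hx0 : 0 < x⟩ :=
      ((eventually_gt_of_hasDerivWithinAt_Ioi_pos h0.neg (by linarith)).and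
        self_mem_nhdsWithin).exists
    simp only [Pi.neg_apply, neg_lt_neg_iff] at hx
    obtain ⟨b, hb, hbd⟩ := exists_deriv_eq_slope h hx0 (hc.mono Icc_subset_Ici_self)
      (fun y hy => (hd y hy.1).differentiableWithinAt)
    have hlt : b * deriv h b < 0 := by
      refine mul_neg_of_pos_of_neg hb.1 ?_
      rw [hbd]
      exact div_neg_of_neg_of_pos (by linarith) (by linarith)
    refine ⟨b * deriv h b / (2 * L), b, div_pos_of_neg_of_neg hlt (by linarith), hb.1, ?_⟩
    have : b * deriv h b / (2 * L) * L = b * deriv h b / 2 := by field_simp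
    linarith
  · refine ⟨(|deriv h 1| + 1) / L, 1, by positivity, one_pos, ?_⟩
    rw [div_mul_cancel₀ _ hL]
    linarith [le_abs_self (deriv h 1)]

theorem statement2 (g : ℝ → ℝ)
    (hg_cont : ContinuousOn g (Set.Ici 0))
    (hg_smooth : ContDiffOn ℝ 2 g (Set.Ioi 0))
    (hP1 : StrictConvexOn ℝ (Set.Ici 0) (fun x => g (Real.sqrt x)))
    (L : ℝ) (hL : L ≠ 0)
    (hderiv : Tendsto (fun x => (g (Real.sqrt x) - g 0) / x) (nhdsWithin 0 (Set.Ioi 0)) (nhds L))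
    (m : ℕ) (hm : 2 ≤ m) :
    ∃ α β : Fin m → ℝ, (∀ i, 0 < α i) ∧ (∀ i, 0 < β i) ∧
      ¬ IsLocalMaxOn (fun u : EuclideanSpace ℝ (Fin m) => ∑ i, α i * g (β i * |u i|))
          (sphere (0 : EuclideanSpace ℝ (Fin m)) 1)
          (EuclideanSpace.single (⟨0, by omega⟩ : Fin m) 1) := by
  obtain ⟨n, rfl⟩ : ∃ n, m = n + 2 := ⟨m - 2, by omega⟩
  set h : ℝ → ℝ := fun x => g (Real.sqrt x) with h_def
  have h_cont : ContinuousOn h (Ici 0) :=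
    hg_cont.comp Real.continuous_sqrt.continuousOn fun x _ => Real.sqrt_nonneg x
  have h_diff : ∀ x, 0 < x → DifferentiableAt ℝ h x := fun x hx =>
    ((hg_smooth.contDiffAt (Ioi_mem_nhds (Real.sqrt_pos.2 hx))).differentiableAt
      (by norm_num)).comp x (Real.hasDerivAt_sqrt hx.ne').differentiableAt
  have h_right : HasDerivWithinAt h L (Ioi 0) 0 := by
    rw [hasDerivWithinAt_iff_tendsto_slope' (by simp)]
    refine hderiv.congr fun x => ?_
    simp [slope_def_field, h_def]
  obtain ⟨a, b, ha, hb, hab⟩ := exists_pos_mul_deriv_lt h_cont h_diff hL h_right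
  refine ⟨Fin.cons 1 fun _ => a, Fin.cons (Real.sqrt b) fun _ => 1, ?_, ?_, fun hmax => ?_⟩
  · intro i
    cases i using Fin.cases <;> simp [ha]
  · intro i
    cases i using Fin.cases <;> simp [hb]
  have h_gt : ∀ᶠ t in nhdsWithin (0 : ℝ) (Ioi 0),
      h (b * (1 - 0)) + a * h 0 < h (b * (1 - t)) + a * h t := by
    have h_lin : HasDerivAt (fun t : ℝ => b * (1 - t)) (b * (-1)) 0 :=
      ((hasDerivAt_id (0 : ℝ)).const_sub 1).const_mul b
    have h_first : HasDerivAt (fun t => h (b * (1 - t))) (deriv h b * (b * (-1))) 0 :=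
      HasDerivAt.comp (h₂ := h) 0 (by simpa using (h_diff b hb).hasDerivAt) h_lin
    exact eventually_gt_of_hasDerivWithinAt_Ioi_pos
      (f := fun t => h (b * (1 - t)) + a * h t)
      (h_first.hasDerivWithinAt.add (h_right.const_mul a)) (by linarith)
  let u : ℝ → EuclideanSpace ℝ (Fin (n + 2)) := fun t =>
    EuclideanSpace.single 0 (Real.sqrt (1 - t)) + EuclideanSpace.single 1 (Real.sqrt t)
  have u_zero : ∀ t, u t 0 = Real.sqrt (1 - t) := fun t => by simp [u]
  have u_one : ∀ t, u t 1 = Real.sqrt t := fun t => by simp [u]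
  have u_rest : ∀ t (i : Fin n), u t i.succ.succ = 0 := fun t i => by
    simp [u, Fin.ext_iff]
  have u_start : u 0 = EuclideanSpace.single 0 1 := by simp [u]
  have u_cont : Continuous u := by
    have h_single : ∀ i : Fin (n + 2),
        Continuous fun x : ℝ => EuclideanSpace.single i x := fun i =>
      (isometry_iff_dist_eq.2 fun x y => PiLp.dist_single_same 2 (fun _ => ℝ) i x y).continuous
    exact ((h_single 0).comp (by fun_prop)).add ((h_single 1).comp (by fun_prop))
  have u_sphere : ∀ t ∈ Ioo (0 : ℝ) 1, u t ∈ sphere (0 : EuclideanSpace ℝ (Fin (n + 2))) 1 := by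
    intro t ht
    rw [mem_sphere_zero_iff_norm, EuclideanSpace.norm_eq, Fin.sum_univ_succ, Fin.sum_univ_succ,
      Fin.succ_zero_eq_one]
    simp [u_zero, u_one, u_rest, Real.sq_sqrt ht.1.le, Real.sq_sqrt (sub_nonneg.2 ht.2.le)]
  have u_tendsto : Tendsto u (nhdsWithin 0 (Ioi 0))
      (nhdsWithin (EuclideanSpace.single 0 1) (sphere 0 1)) := by
    refine tendsto_nhdsWithin_iff.2 ⟨?_, ?_⟩
    · exact u_start ▸ (u_cont.tendsto 0).mono_left nhdsWithin_le_nhds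
    · filter_upwards [Ioo_mem_nhdsGT one_pos] with t ht using u_sphere t ht
  obtain ⟨t, ht_le, ht_gt⟩ := ((u_tendsto.eventually hmax).and h_gt).exists
  have F_eq : ∀ t, ∑ i, (Fin.cons 1 fun _ => a : Fin (n + 2) → ℝ) i *
      g ((Fin.cons (Real.sqrt b) fun _ => 1 : Fin (n + 2) → ℝ) i * |u t i|) =
      h (b * (1 - t)) + a * h t + n * (a * g 0) := by
    intro t
    rw [Fin.sum_univ_succ, Fin.sum_univ_succ]
    simp only [Fin.cons_zero, Fin.cons_succ, u_rest]
    rw [Fin.succ_zero_eq_one, u_zero, u_one]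
    simp [h_def, Real.sqrt_mul hb.le, abs_of_nonneg (Real.sqrt_nonneg _), add_assoc]
  have F_le : h (b * (1 - t)) + a * h t + n * (a * g 0) ≤
      h (b * (1 - 0)) + a * h 0 + n * (a * g 0) := by
    rw [← F_eq, ← F_eq, u_start]
    exact ht_le
  linarith
end
end

section
/- Let A ∈ ℝ^{n×n} be a symmetric matrix with nonnegative entries, and suppose the index set {1,…,n} is partitioned into nonempty sets S₁,…,S_m such that a_{ij} = 0 whenever i and j lie in different sets, and such that for each j the graph on vertex set S_j with an edge between i and i' whenever a_{ii'} > 0 is connected. Let D be the diagonal matrix with d_{ii} = Σ_{j=1}^n a_{ij} and let L = D − A be the unnormalized graph Laplacian. Then the null space N(L) of L has dimension m; and if X ∈ ℝ^{n×m} is any matrix whose columns are pairwise orthogonal vectors of Euclidean norm √n spanning N(L), then there exist mutually orthogonal unit vectors Z₁,…,Z_m ∈ ℝ^m such that for every j ∈ {1,…,m} and every i ∈ S_j, the i-th row of X equals (1/√(w_j)) · Z_jᵀ, where w_j = |S_j| / n. -/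
open Filter Set Metric

noncomputable section

/-- The Dirichlet energy of a vector killed by the graph Laplacian vanishes, so the vector takes the
same value at both ends of every edge. -/
theorem eq_of_laplacian_mulVec_eq_zero {V : Type*} [Fintype V]
    {A : Matrix V V ℝ} (hsymm : A.IsSymm) (hnonneg : ∀ i j, 0 ≤ A i j) {v : V → ℝ}
    (hv : ∀ i, ∑ j, A i j * (v i - v j) = 0) {i j : V} (hij : 0 < A i j) : v i = v j := by
  have energy : ∑ i, ∑ j, A i j * (v i - v j) ^ 2 = 0 := by
    have first : ∑ i, ∑ j, v i * (A i j * (v i - v j)) = 0 := by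
      simp [← Finset.mul_sum, hv]
    have second : ∑ i, ∑ j, v j * (A i j * (v j - v i)) = 0 := by
      rw [Finset.sum_comm, ← first]
      refine Finset.sum_congr rfl fun i _ => Finset.sum_congr rfl fun j _ => ?_
      rw [hsymm.apply]
    have total := congrArg₂ (· + ·) first second
    simp only [← Finset.sum_add_distrib, add_zero] at total
    rw [← total]
    refine Finset.sum_congr rfl fun i _ => Finset.sum_congr rfl fun j _ => ?_
    ring
  have term_nonneg : ∀ i j, 0 ≤ A i j * (v i - v j) ^ 2 := fun i j =>
    mul_nonneg (hnonneg i j) (sq_nonneg _)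
  have row := (Finset.sum_eq_zero_iff_of_nonneg
    fun i _ => Finset.sum_nonneg fun j _ => term_nonneg i j).1 energy i (Finset.mem_univ i)
  have term := (Finset.sum_eq_zero_iff_of_nonneg fun j _ => term_nonneg i j).1 row j
    (Finset.mem_univ j)
  have sq_zero := (mul_eq_zero.1 term).resolve_left hij.ne'
  exact sub_eq_zero.1 (pow_eq_zero_iff two_ne_zero |>.1 sq_zero)

/-- The kernel of a graph Laplacian consists of the functions that are constant on the connected
components, given here as the fibres of `σ`. -/
theorem ker_laplacian_eq_range_funLeft {V W : Type*} [Fintype V] [DecidableEq V]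
    {A : Matrix V V ℝ} (hsymm : A.IsSymm) (hnonneg : ∀ i j, 0 ≤ A i j)
    {σ : V → W} (hσ : Function.Surjective σ) (hblock : ∀ i j, σ i ≠ σ j → A i j = 0)
    (hconn : ∀ i j, σ i = σ j → Relation.ReflTransGen (fun a b => 0 < A a b) i j) :
    LinearMap.ker (Matrix.diagonal (fun i => ∑ j, A i j) - A).mulVecLin =
      LinearMap.range (LinearMap.funLeft ℝ ℝ σ) := by
  have mem_ker : ∀ v : V → ℝ,
      v ∈ LinearMap.ker (Matrix.diagonal (fun i => ∑ j, A i j) - A).mulVecLin ↔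
        ∀ i, ∑ j, A i j * (v i - v j) = 0 := by
    intro v
    rw [LinearMap.mem_ker, Matrix.mulVecLin_apply, funext_iff]
    refine forall_congr' fun i => ?_
    simp only [Matrix.sub_mulVec, Pi.sub_apply, Matrix.mulVec_diagonal, Pi.zero_apply, mul_sub,
      Finset.sum_sub_distrib, Finset.sum_mul]
    rfl
  ext v
  rw [mem_ker, LinearMap.mem_range]
  constructor
  · intro hv
    have hconst : ∀ i j, σ i = σ j → v i = v j := by
      intro i j hij
      have hpath := hconn i j hij
      clear hij
      induction hpath with
      | refl => rfl
      | tail _ hbc ih => exact ih.trans (eq_of_laplacian_mulVec_eq_zero hsymm hnonneg hv hbc)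
    exact ⟨fun w => v (Function.surjInv hσ w), funext fun i =>
      hconst _ _ (Function.surjInv_eq hσ (σ i))⟩
  · rintro ⟨c, rfl⟩ i
    refine Finset.sum_eq_zero fun j _ => ?_
    by_cases hij : σ i = σ j
    · simp [LinearMap.funLeft_apply, hij]
    · simp [hblock i j hij]

/-- The rows of a square real matrix with orthonormal columns are orthonormal. -/
theorem orthonormal_rows_of_transpose_mul_self_eq_one {W : Type*} [Fintype W] [DecidableEq W]
    {M : Matrix W W ℝ} (hM : M.transpose * M = 1) :
    Orthonormal ℝ fun j => WithLp.toLp 2 (M j) := by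
  have hM' : M * M.transpose = 1 := mul_eq_one_comm.1 hM
  rw [orthonormal_iff_ite]
  intro i j
  have entry := congrFun (congrFun hM' j) i
  simpa [Matrix.mul_apply, Matrix.one_apply, PiLp.inner_apply, eq_comm] using entry

theorem statement4 (n m : ℕ) (hm : 0 < m)
    (A : Matrix (Fin n) (Fin n) ℝ)
    (hsymm : A.IsSymm) (hnonneg : ∀ i j, 0 ≤ A i j)
    (σ : Fin n → Fin m) (hσ : Function.Surjective σ)
    (hblock : ∀ i j, σ i ≠ σ j → A i j = 0)
    (hconn : ∀ i j, σ i = σ j → Relation.ReflTransGen (fun a b => 0 < A a b) i j)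
    (L : Matrix (Fin n) (Fin n) ℝ)
    (hL : L = Matrix.diagonal (fun i => ∑ j, A i j) - A) :
    Module.finrank ℝ (LinearMap.ker L.mulVecLin) = m ∧
    ∀ x : Fin m → (Fin n → ℝ),
      (∀ k, x k ∈ LinearMap.ker L.mulVecLin) →
      (∀ k l, k ≠ l → ∑ i, x k i * x l i = 0) →
      (∀ k, ∑ i, (x k i) ^ 2 = n) →
      Submodule.span ℝ (Set.range x) = LinearMap.ker L.mulVecLin →
      ∃ Z : Fin m → EuclideanSpace ℝ (Fin m), Orthonormal ℝ Z ∧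
        ∀ j : Fin m, ∀ i : Fin n, σ i = j →
          ∀ k : Fin m, x k i =
            (1 / Real.sqrt
              (((Finset.univ.filter (fun i' => σ i' = j)).card : ℝ) / n)) * Z j k := by
  subst hL
  have hker := ker_laplacian_eq_range_funLeft hsymm hnonneg hσ hblock hconn
  refine ⟨?_, fun x hx horth hnorm _ => ?_⟩
  · rw [hker, LinearMap.finrank_range_of_inj (LinearMap.funLeft_injective_of_surjective ℝ ℝ σ hσ),
      Module.finrank_fin_fun]
  choose c hc using fun k => LinearMap.mem_range.1 (hker ▸ hx k)
  have hxc : ∀ k i, x k i = c k (σ i) := fun k i => (congrFun (hc k) i).symm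
  have hn : (0 : ℝ) < n := by
    obtain ⟨i, -⟩ := hσ ⟨0, hm⟩
    exact_mod_cast i.pos
  let w : Fin m → ℝ := fun j => ((Finset.univ.filter (fun i' => σ i' = j)).card : ℝ) / n
  have hw : ∀ j, 0 < w j := by
    intro j
    obtain ⟨i, hi⟩ := hσ j
    refine div_pos (Nat.cast_pos.2 (Finset.card_pos.2 ⟨i, ?_⟩)) hn
    simpa using hi
  have hsum : ∀ f : Fin m → ℝ, ∑ j, w j * f j = (∑ i, f (σ i)) / n := by
    intro f
    rw [← Finset.sum_fiberwise Finset.univ σ, Finset.sum_div]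
    refine Finset.sum_congr rfl fun j _ => ?_
    rw [Finset.sum_congr rfl fun i hi => congrArg f (Finset.mem_filter.1 hi).2, Finset.sum_const,
      nsmul_eq_mul, div_mul_eq_mul_div]
  let M : Matrix (Fin m) (Fin m) ℝ := Matrix.of fun j k => Real.sqrt (w j) * c k j
  have hM : M.transpose * M = 1 := by
    ext k l
    have hentry : (M.transpose * M) k l = (∑ i, x k i * x l i) / n := by
      simp only [hxc]
      rw [Matrix.mul_apply, ← hsum fun j => c k j * c l j]
      refine Finset.sum_congr rfl fun j _ => ?_
      simp only [M, Matrix.transpose_apply, Matrix.of_apply]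
      rw [mul_mul_mul_comm, Real.mul_self_sqrt (hw j).le]
    rw [hentry]
    rcases eq_or_ne k l with rfl | hkl
    · simp only [← sq, hnorm, Matrix.one_apply_eq, div_self hn.ne']
    · rw [horth k l hkl, zero_div, Matrix.one_apply_ne hkl]
  refine ⟨_, orthonormal_rows_of_transpose_mul_self_eq_one hM, ?_⟩
  rintro _ i rfl k
  have hsqrt : Real.sqrt (w (σ i)) ≠ 0 := (Real.sqrt_pos.2 (hw _)).ne'
  change x k i = 1 / Real.sqrt (w (σ i)) * (Real.sqrt (w (σ i)) * c k (σ i))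
  rw [hxc]
  field_simp
end
end

section
/- Let A ∈ ℝ^{n×n} be a symmetric matrix with nonnegative entries, and suppose the index set {1,…,n} is partitioned into nonempty sets S₁,…,S_m such that a_{ij} = 0 whenever i and j lie in different sets, and such that for each j the graph on vertex set S_j with an edge between i and i' whenever a_{ii'} > 0 is connected. Let D be the diagonal matrix with d_{ii} = Σ_{j=1}^n a_{ij}, assume d_{ii} > 0 for all i, and let L_sym = D^{−1/2} (D − A) D^{−1/2} be the symmetric normalized graph Laplacian. Then the null space N(L_sym) has dimension m; and if X ∈ ℝ^{n×m} is any matrix whose columns are pairwise orthogonal vectors of Euclidean norm √n spanning N(L_sym), then there exist mutually orthogonal unit vectors Z₁,…,Z_m ∈ ℝ^m such that for every j ∈ {1,…,m} and every i ∈ S_j, the i-th row of X equals √(n · d_{ii} / δ(S_j)) · Z_jᵀ, where δ(S_j) = Σ_{i ∈ S_j} d_{ii}. -/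
open Filter Set Metric

noncomputable section

/-- The vectors that are constant multiples of the square roots of the degrees on each block,
as the image of the vector of these constants. -/
def blockScaling {ι κ : Type*} (σ : ι → κ) (d : ι → ℝ) : (κ → ℝ) →ₗ[ℝ] (ι → ℝ) where
  toFun c i := Real.sqrt (d i) * c (σ i)
  map_add' c c' := by ext i; simp [mul_add]
  map_smul' r c := by ext i; simp [mul_left_comm]

lemma blockScaling_apply {ι κ : Type*} (σ : ι → κ) (d : ι → ℝ) (c : κ → ℝ) (i : ι) :
    blockScaling σ d c i = Real.sqrt (d i) * c (σ i) := rfl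

lemma blockScaling_injective {ι κ : Type*} {σ : ι → κ} (hσ : Function.Surjective σ)
    {d : ι → ℝ} (hd : ∀ i, 0 < d i) : Function.Injective (blockScaling σ d) := by
  intro c c' h
  ext k
  obtain ⟨i, rfl⟩ := hσ k
  have hi := congrFun h i
  simp only [blockScaling_apply] at hi
  exact mul_left_cancel₀ (Real.sqrt_ne_zero'.2 (hd i)) hi

/-- A harmonic function on a weighted graph takes the same value at adjacent vertices. -/
lemma eq_of_pos_of_harmonic {ι : Type*} [Fintype ι] {A : Matrix ι ι ℝ} (hA : A.IsSymm)
    (hnonneg : ∀ i j, 0 ≤ A i j) {u : ι → ℝ}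
    (hu : ∀ i, (∑ j, A i j) * u i = ∑ j, A i j * u j) {i j : ι} (hij : 0 < A i j) :
    u i = u j := by
  have hcross : ∑ a, ∑ b, A a b * (u a * u b) = ∑ a, ∑ b, A a b * u a ^ 2 := by
    refine Finset.sum_congr rfl fun a _ => ?_
    calc ∑ b, A a b * (u a * u b) = u a * ∑ b, A a b * u b := by
          rw [Finset.mul_sum]
          exact Finset.sum_congr rfl fun b _ => by ring
      _ = ∑ b, A a b * u a ^ 2 := by
          rw [← hu a, ← Finset.sum_mul]
          ring
  have hswap : ∑ a, ∑ b, A a b * u b ^ 2 = ∑ a, ∑ b, A a b * u a ^ 2 := by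
    rw [Finset.sum_comm]
    exact Finset.sum_congr rfl fun a _ => Finset.sum_congr rfl fun b _ => by rw [hA.apply]
  have hzero : ∑ a, ∑ b, A a b * (u a - u b) ^ 2 = 0 := by
    calc ∑ a, ∑ b, A a b * (u a - u b) ^ 2
        = ∑ a, ∑ b, A a b * u a ^ 2 - 2 * ∑ a, ∑ b, A a b * (u a * u b)
          + ∑ a, ∑ b, A a b * u b ^ 2 := by
          simp only [Finset.mul_sum, ← Finset.sum_sub_distrib, ← Finset.sum_add_distrib]
          exact Finset.sum_congr rfl fun a _ => Finset.sum_congr rfl fun b _ => by ring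
      _ = 0 := by
          rw [hcross, hswap]
          ring
  have hterm : ∀ a b, 0 ≤ A a b * (u a - u b) ^ 2 := fun a b =>
    mul_nonneg (hnonneg a b) (sq_nonneg _)
  have hrow := (Finset.sum_eq_zero_iff_of_nonneg
    fun a _ => Finset.sum_nonneg fun b _ => hterm a b).1 hzero i (Finset.mem_univ i)
  have hentry := (Finset.sum_eq_zero_iff_of_nonneg fun b _ => hterm i b).1 hrow j
    (Finset.mem_univ j)
  exact sub_eq_zero.1 (pow_eq_zero_iff two_ne_zero |>.1
    ((mul_eq_zero.1 hentry).resolve_left hij.ne'))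

lemma normalizedLaplacian_mulVec_apply {ι : Type*} [Fintype ι] [DecidableEq ι]
    (A : Matrix ι ι ℝ) (d v : ι → ℝ) (i : ι) :
    ((Matrix.diagonal (fun i => (Real.sqrt (d i))⁻¹) * (Matrix.diagonal d - A) *
        Matrix.diagonal (fun i => (Real.sqrt (d i))⁻¹)).mulVec v) i =
      (Real.sqrt (d i))⁻¹ * (d i * ((Real.sqrt (d i))⁻¹ * v i) -
        ∑ j, A i j * ((Real.sqrt (d j))⁻¹ * v j)) := by
  rw [← Matrix.mulVec_mulVec, ← Matrix.mulVec_mulVec, Matrix.mulVec_diagonal,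
    Matrix.sub_mulVec, Pi.sub_apply, Matrix.mulVec_diagonal, Matrix.mulVec_diagonal]
  congr 2
  exact Finset.sum_congr rfl fun j _ => by rw [Matrix.mulVec_diagonal]

/-- The null space of the normalized Laplacian of a weighted graph whose connected components are
the fibres of `σ`. -/
lemma ker_normalizedLaplacian {ι κ : Type*} [Fintype ι] [DecidableEq ι] {A : Matrix ι ι ℝ}
    (hA : A.IsSymm) (hnonneg : ∀ i j, 0 ≤ A i j)
    {σ : ι → κ} (hσ : Function.Surjective σ) (hblock : ∀ i j, σ i ≠ σ j → A i j = 0)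
    (hconn : ∀ i j, σ i = σ j → Relation.ReflTransGen (fun a b => 0 < A a b) i j)
    {d : ι → ℝ} (hd : ∀ i, d i = ∑ j, A i j) (hdpos : ∀ i, 0 < d i) :
    LinearMap.ker (Matrix.diagonal (fun i => (Real.sqrt (d i))⁻¹) *
        (Matrix.diagonal d - A) * Matrix.diagonal (fun i => (Real.sqrt (d i))⁻¹)).mulVecLin =
      LinearMap.range (blockScaling σ d) := by
  have hsqrt : ∀ i, Real.sqrt (d i) ≠ 0 := fun i => (Real.sqrt_pos.2 (hdpos i)).ne'
  ext v
  rw [LinearMap.mem_ker, Matrix.mulVecLin_apply, LinearMap.mem_range]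
  constructor
  · intro hv
    have hharm : ∀ i, (∑ j, A i j) * ((Real.sqrt (d i))⁻¹ * v i) =
        ∑ j, A i j * ((Real.sqrt (d j))⁻¹ * v j) := by
      intro i
      have hi := congrFun hv i
      rw [normalizedLaplacian_mulVec_apply, Pi.zero_apply] at hi
      rw [← hd i]
      exact sub_eq_zero.1 ((mul_eq_zero.1 hi).resolve_left (inv_ne_zero (hsqrt i)))
    have hconst : ∀ i j, σ i = σ j →
        (Real.sqrt (d i))⁻¹ * v i = (Real.sqrt (d j))⁻¹ * v j := by
      intro i j hij
      have hpath := hconn i j hij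
      clear hij
      induction hpath with
      | refl => rfl
      | tail _ hbc ih =>
        exact ih.trans (eq_of_pos_of_harmonic
          (u := fun i => (Real.sqrt (d i))⁻¹ * v i) hA hnonneg hharm hbc)
    choose r hr using hσ
    refine ⟨fun k => (Real.sqrt (d (r k)))⁻¹ * v (r k), ?_⟩
    ext i
    rw [blockScaling_apply, hconst (r (σ i)) i (hr _), mul_inv_cancel_left₀ (hsqrt i)]
  · rintro ⟨c, rfl⟩
    ext i
    rw [normalizedLaplacian_mulVec_apply]
    simp only [blockScaling_apply, inv_mul_cancel_left₀ (hsqrt _)]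
    have hsum : ∑ j, A i j * c (σ j) = d i * c (σ i) := by
      rw [hd i, Finset.sum_mul]
      refine Finset.sum_congr rfl fun j _ => ?_
      by_cases h : σ i = σ j
      · rw [h]
      · rw [hblock i j h, zero_mul, zero_mul]
    rw [hsum, sub_self, mul_zero, Pi.zero_apply]

lemma sum_blockScaling_mul {ι κ : Type*} [Fintype ι] [Fintype κ] [DecidableEq κ]
    (σ : ι → κ) {d : ι → ℝ} (hd : ∀ i, 0 ≤ d i) (c c' : κ → ℝ) :
    ∑ i, blockScaling σ d c i * blockScaling σ d c' i =
      ∑ j, (∑ i ∈ Finset.univ.filter (fun i => σ i = j), d i) * (c j * c' j) := by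
  rw [← Finset.sum_fiberwise Finset.univ σ]
  refine Finset.sum_congr rfl fun j _ => ?_
  rw [Finset.sum_mul]
  refine Finset.sum_congr rfl fun i hi => ?_
  rw [blockScaling_apply, blockScaling_apply, (Finset.mem_filter.1 hi).2,
    mul_mul_mul_comm, Real.mul_self_sqrt (hd i)]

/-- If the rows of a square real matrix are orthonormal, then so are its columns. -/
lemma orthonormal_col_of_mul_transpose_eq_one {κ : Type*} [Fintype κ] [DecidableEq κ]
    {M : Matrix κ κ ℝ} (hM : M * M.transpose = 1) :
    Orthonormal ℝ fun j => WithLp.toLp 2 fun k => M k j := by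
  rw [orthonormal_iff_ite]
  intro i j
  have hM' : M.transpose * M = 1 := mul_eq_one_comm.1 hM
  have h := congrFun (congrFun hM' i) j
  rw [Matrix.mul_apply, Matrix.one_apply] at h
  rw [← h, PiLp.inner_apply]
  exact Finset.sum_congr rfl fun k _ => by simp [mul_comm]

theorem statement5 (n m : ℕ) (hm : 0 < m)
    (A : Matrix (Fin n) (Fin n) ℝ)
    (hsymm : A.IsSymm) (hnonneg : ∀ i j, 0 ≤ A i j)
    (σ : Fin n → Fin m) (hσ : Function.Surjective σ)
    (hblock : ∀ i j, σ i ≠ σ j → A i j = 0)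
    (hconn : ∀ i j, σ i = σ j → Relation.ReflTransGen (fun a b => 0 < A a b) i j)
    (d : Fin n → ℝ) (hd : ∀ i, d i = ∑ j, A i j) (hdpos : ∀ i, 0 < d i)
    (Lsym : Matrix (Fin n) (Fin n) ℝ)
    (hLsym : Lsym = Matrix.diagonal (fun i => (Real.sqrt (d i))⁻¹) *
        (Matrix.diagonal d - A) * Matrix.diagonal (fun i => (Real.sqrt (d i))⁻¹)) :
    Module.finrank ℝ (LinearMap.ker Lsym.mulVecLin) = m ∧
    ∀ x : Fin m → (Fin n → ℝ),
      (∀ k, x k ∈ LinearMap.ker Lsym.mulVecLin) →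
      (∀ k l, k ≠ l → ∑ i, x k i * x l i = 0) →
      (∀ k, ∑ i, (x k i) ^ 2 = n) →
      Submodule.span ℝ (Set.range x) = LinearMap.ker Lsym.mulVecLin →
      ∃ Z : Fin m → EuclideanSpace ℝ (Fin m), Orthonormal ℝ Z ∧
        ∀ j : Fin m, ∀ i : Fin n, σ i = j →
          ∀ k : Fin m, x k i =
            Real.sqrt ((n * d i) / (∑ i' ∈ Finset.univ.filter (fun i' => σ i' = j), d i')) *
              Z j k := by
  subst hLsym
  have hker := ker_normalizedLaplacian hsymm hnonneg hσ hblock hconn hd hdpos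
  refine ⟨?_, fun x hx horth hnorm _ => ?_⟩
  · rw [hker, LinearMap.finrank_range_of_inj (blockScaling_injective hσ hdpos),
      Module.finrank_fin_fun]
  · rw [hker] at hx
    choose c hc using hx
    have hn : (0 : ℝ) < n := by
      obtain ⟨i, -⟩ := hσ ⟨0, hm⟩
      exact_mod_cast i.pos
    let δ : Fin m → ℝ := fun j => ∑ i ∈ Finset.univ.filter (fun i => σ i = j), d i
    have hδpos : ∀ j, 0 < δ j := by
      intro j
      obtain ⟨i, hi⟩ := hσ j
      exact Finset.sum_pos (fun i _ => hdpos i) ⟨i, by simp [hi]⟩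
    have hgram : ∀ k l, ∑ i, x k i * x l i = ∑ j, δ j * (c k j * c l j) := by
      intro k l
      rw [← hc k, ← hc l]
      exact sum_blockScaling_mul σ (fun i => (hdpos i).le) (c k) (c l)
    let M : Matrix (Fin m) (Fin m) ℝ := Matrix.of fun k j => Real.sqrt (δ j / n) * c k j
    have hMapply : ∀ k j, M k j = Real.sqrt (δ j / n) * c k j := fun _ _ => rfl
    have hM : M * M.transpose = 1 := by
      ext k l
      have hentry : (M * M.transpose) k l = (∑ i, x k i * x l i) / n := by
        rw [hgram, Matrix.mul_apply, Finset.sum_div]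
        refine Finset.sum_congr rfl fun j _ => ?_
        rw [Matrix.transpose_apply, hMapply, hMapply, mul_mul_mul_comm,
          Real.mul_self_sqrt (div_pos (hδpos j) hn).le]
        ring
      rw [hentry, Matrix.one_apply]
      split_ifs with hkl
      · subst hkl
        simp only [← pow_two]
        rw [hnorm, div_self hn.ne']
      · rw [horth k l hkl, zero_div]
    refine ⟨_, orthonormal_col_of_mul_transpose_eq_one hM, ?_⟩
    rintro j i rfl k
    change x k i = Real.sqrt (n * d i / δ (σ i)) * (Real.sqrt (δ (σ i) / n) * c k (σ i))
    have hprod : n * d i / δ (σ i) * (δ (σ i) / n) = d i := by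
      have := (hδpos (σ i)).ne'
      field_simp
    rw [← mul_assoc, ← Real.sqrt_mul (div_pos (mul_pos hn (hdpos i)) (hδpos _)).le, hprod,
      ← hc k, blockScaling_apply]
end
end

section
/- Let g₁,…,g_m : [0,∞) → ℝ be functions such that for each i the map t ↦ g_i(√t) is strictly convex on [0,∞), and let F : ℝ^m → ℝ be given by F(u) = Σ_{i=1}^m g_i(|u_i|). Then the set of local maxima of F relative to the unit sphere S^{m−1} is contained in the set {±e_i : 1 ≤ i ≤ m} of signed canonical basis vectors. -/
open Filter Set Metric

noncomputable section

/-- The point obtained from `u` by moving its squared coordinates to `u k ^ 2 * (1 + s * c k)`. -/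
def squareShift {ι : Type*} (u : EuclideanSpace ℝ ι) (c : ι → ℝ) (s : ℝ) :
    EuclideanSpace ℝ ι :=
  WithLp.toLp 2 fun k => u k * Real.sqrt (1 + s * c k)

lemma squareShift_apply {ι : Type*} (u : EuclideanSpace ℝ ι) (c : ι → ℝ) (s : ℝ) (k : ι) :
    squareShift u c s k = u k * Real.sqrt (1 + s * c k) := rfl

lemma squareShift_zero {ι : Type*} (u : EuclideanSpace ℝ ι) (c : ι → ℝ) :
    squareShift u c 0 = u := by
  ext k
  simp [squareShift_apply]

lemma continuous_squareShift {ι : Type*} (u : EuclideanSpace ℝ ι) (c : ι → ℝ) :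
    Continuous (squareShift u c) := by
  unfold squareShift
  fun_prop

lemma abs_squareShift_apply {ι : Type*} (u : EuclideanSpace ℝ ι) (c : ι → ℝ) (s : ℝ) (k : ι) :
    |squareShift u c s k| = Real.sqrt (u k ^ 2 * (1 + s * c k)) := by
  rw [squareShift_apply, abs_mul, abs_of_nonneg (Real.sqrt_nonneg _),
    Real.sqrt_mul (sq_nonneg _), Real.sqrt_sq_eq_abs]

lemma mem_unitSphere_iff {ι : Type*} [Fintype ι] (u : EuclideanSpace ℝ ι) :
    u ∈ sphere (0 : EuclideanSpace ℝ ι) 1 ↔ ∑ k, u k ^ 2 = 1 := by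
  rw [mem_sphere_zero_iff_norm, EuclideanSpace.norm_eq, Real.sqrt_eq_one]
  simp

lemma squareShift_mem_sphere {ι : Type*} [Fintype ι] {u : EuclideanSpace ℝ ι} {c : ι → ℝ}
    {s : ℝ} (hu : u ∈ sphere (0 : EuclideanSpace ℝ ι) 1) (hc : ∑ k, u k ^ 2 * c k = 0)
    (hs : ∀ k, 0 ≤ 1 + s * c k) :
    squareShift u c s ∈ sphere (0 : EuclideanSpace ℝ ι) 1 := by
  rw [mem_unitSphere_iff] at hu ⊢
  calc ∑ k, squareShift u c s k ^ 2 = ∑ k, (u k ^ 2 + s * (u k ^ 2 * c k)) := by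
        refine Finset.sum_congr rfl fun k _ => ?_
        rw [squareShift_apply, mul_pow, Real.sq_sqrt (hs k)]
        ring
    _ = 1 := by rw [Finset.sum_add_distrib, ← Finset.mul_sum, hu, hc]; ring

/-- A local maximum on the sphere of a separable function, strictly convex in the squared
coordinates, admits no nontrivial tangential perturbation of its squared coordinates. -/
lemma mul_eq_zero_of_isLocalMaxOn_sphere {ι : Type*} [Fintype ι] {g : ι → ℝ → ℝ}
    (hconv : ∀ i, StrictConvexOn ℝ (Ici 0) (fun t => g i (Real.sqrt t)))
    {u : EuclideanSpace ℝ ι} (hu : u ∈ sphere (0 : EuclideanSpace ℝ ι) 1)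
    (hmax : IsLocalMaxOn (fun v : EuclideanSpace ℝ ι => ∑ i, g i |v i|)
      (sphere (0 : EuclideanSpace ℝ ι) 1) u)
    {c : ι → ℝ} (hc : ∑ k, u k ^ 2 * c k = 0) (i : ι) : u i * c i = 0 := by
  by_contra hi
  have hpos : ∀ᶠ s in nhds (0 : ℝ), ∀ k, 0 < 1 + s * c k := by
    refine eventually_all.2 fun k => ?_
    have : Continuous fun s : ℝ => 1 + s * c k := by fun_prop
    exact this.continuousAt.eventually_const_lt (by simp)
  have hle : ∀ᶠ s in nhds (0 : ℝ),
      ∑ k, g k |squareShift u c s k| ≤ ∑ k, g k |u k| := by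
    have ht : Tendsto (squareShift u c) (nhds 0) (nhds u) := by
      simpa only [squareShift_zero] using (continuous_squareShift u c).tendsto 0
    filter_upwards [ht.eventually (eventually_nhdsWithin_iff.1 hmax), hpos] with s h hs
    exact h (squareShift_mem_sphere hu hc fun k => (hs k).le)
  have hneg : Tendsto (fun s : ℝ => -s) (nhds 0) (nhds 0) := by
    simpa using (continuous_neg (G := ℝ)).tendsto 0
  have hall := (hpos.and hle).and (hneg.eventually (hpos.and hle))
  obtain ⟨s, ⟨⟨hp, hlp⟩, hm, hlm⟩, hs⟩ :=
    ((hall.filter_mono nhdsWithin_le_nhds).and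
      (self_mem_nhdsWithin : Ioi (0 : ℝ) ∈ nhdsWithin 0 (Ioi 0))).exists
  have hmem : ∀ {r : ℝ}, (∀ k, 0 < 1 + r * c k) → ∀ k, u k ^ 2 * (1 + r * c k) ∈ Ici (0 : ℝ) :=
    fun h k => mul_nonneg (sq_nonneg _) (h k).le
  have hmid : ∀ k, (1 / 2 : ℝ) • (u k ^ 2 * (1 + s * c k)) +
      (1 / 2 : ℝ) • (u k ^ 2 * (1 + -s * c k)) = u k ^ 2 := fun k => by
    simp only [smul_eq_mul]; ring
  have hlt : ∑ k, g k |u k| <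
      ∑ k, (1 / 2 * g k |squareShift u c s k| + 1 / 2 * g k |squareShift u c (-s) k|) := by
    refine Finset.sum_lt_sum (fun k _ => ?_) ⟨i, Finset.mem_univ i, ?_⟩
    · have h := (hconv k).convexOn.2 (hmem hp k) (hmem hm k)
        one_half_pos.le one_half_pos.le (add_halves (1 : ℝ))
      rw [hmid] at h
      simpa only [abs_squareShift_apply, Real.sqrt_sq_eq_abs, smul_eq_mul] using h
    · have hne : u i ^ 2 * (1 + s * c i) ≠ u i ^ 2 * (1 + -s * c i) := by
        intro h
        have : s * (u i * (u i * c i)) = 0 := by linarith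
        simp only [mul_eq_zero] at this hi
        have := ne_of_gt hs
        tauto
      have h := (hconv i).2 (hmem hp i) (hmem hm i) hne
        one_half_pos one_half_pos (add_halves (1 : ℝ))
      rw [hmid] at h
      simpa only [abs_squareShift_apply, Real.sqrt_sq_eq_abs, smul_eq_mul] using h
  rw [Finset.sum_add_distrib, ← Finset.mul_sum, ← Finset.mul_sum] at hlt
  linarith

theorem statement7 (m : ℕ) (g : Fin m → ℝ → ℝ)
    (hconv : ∀ i, StrictConvexOn ℝ (Set.Ici 0) (fun t => g i (Real.sqrt t)))
    (F : EuclideanSpace ℝ (Fin m) → ℝ)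
    (hF : ∀ u, F u = ∑ i, g i |u i|) :
    ∀ u ∈ sphere (0 : EuclideanSpace ℝ (Fin m)) 1,
      IsLocalMaxOn F (sphere (0 : EuclideanSpace ℝ (Fin m)) 1) u →
      ∃ i, u = EuclideanSpace.single i 1 ∨ u = -EuclideanSpace.single i 1 := by
  intro u hu hmax
  obtain rfl : F = fun v => ∑ i, g i |v i| := funext hF
  have hsum := (mem_unitSphere_iff u).1 hu
  obtain ⟨i, -, hi⟩ := Finset.exists_ne_zero_of_sum_ne_zero (hsum.trans_ne one_ne_zero)
  have hoff : ∀ j, j ≠ i → u j = 0 := by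
    intro j hji
    by_contra hj
    have hc : ∑ k, u k ^ 2 *
        (Pi.single i (u i ^ 2)⁻¹ - Pi.single j (u j ^ 2)⁻¹ : Fin m → ℝ) k = 0 := by
      simp [mul_sub, Finset.sum_sub_distrib, Pi.single_apply, hj, mul_inv_cancel₀ hi]
    have h := mul_eq_zero_of_isLocalMaxOn_sphere hconv hu hmax hc j
    simp [hji, hj] at h
  have hsq : u i ^ 2 = 1 := by
    rwa [Finset.sum_eq_single i (fun j _ hj => by simp [hoff j hj]) (by simp)] at hsum
  refine ⟨i, (by simpa using hsq : u i = 1 ∨ u i = -1).imp (fun h => ?_) fun h => ?_⟩ <;>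
  · ext k
    by_cases hk : k = i
    · subst hk; simp [h]
    · simp [hk, hoff k hk]
end
end

section
/- Let h : [0,∞) → ℝ be a strictly convex function, let w₁,…,w_m > 0 (not necessarily summing to 1), and let H : [0,∞)^m → ℝ be given by H(x) = Σ_{i=1}^m w_i · h(x_i / w_i). Then each canonical basis vector e_i, 1 ≤ i ≤ m, is a strict local maximum of H relative to the standard simplex Δ^{m−1}. -/
open Filter Set Metric

noncomputable section

/-- A convex function on `[0, ∞)` lies below its chord over `[0, c]`. -/
theorem ConvexOn.le_chord_of_mem_Icc {h : ℝ → ℝ} (hconv : ConvexOn ℝ (Set.Ici 0) h)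
    {c x : ℝ} (hc : 0 < c) (hx : x ∈ Set.Icc 0 c) :
    h x ≤ h 0 + (h c - h 0) / c * x := by
  have key := hconv.2 (Set.mem_Ici.2 le_rfl) (Set.mem_Ici.2 hc.le)
    (sub_nonneg.2 ((div_le_one hc).2 hx.2)) (div_nonneg hx.1 hc.le) (sub_add_cancel 1 (x / c))
  simp only [smul_eq_mul, mul_zero, zero_add, div_mul_cancel₀ x hc.ne'] at key
  exact key.trans_eq (by ring)

/-- A strictly convex function on `[0, ∞)` lies strictly below its chord inside `(0, c)`. -/
theorem StrictConvexOn.lt_chord_of_mem_Ioo {h : ℝ → ℝ} (hconv : StrictConvexOn ℝ (Set.Ici 0) h)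
    {c x : ℝ} (hx : x ∈ Set.Ioo 0 c) :
    h x < h 0 + (h c - h 0) / c * x := by
  have hc : 0 < c := hx.1.trans hx.2
  have key := hconv.2 (Set.mem_Ici.2 le_rfl) (Set.mem_Ici.2 hc.le) hc.ne
    (sub_pos.2 ((div_lt_one hc).2 hx.2)) (div_pos hx.1 hc) (sub_add_cancel 1 (x / c))
  simp only [smul_eq_mul, mul_zero, zero_add, div_mul_cancel₀ x hc.ne'] at key
  exact key.trans_eq (by ring)

/-- A point of the standard simplex other than the vertex `e_i` has `i`-th coordinate below `1`. -/
theorem stdSimplex.apply_lt_one_of_ne_single {ι : Type*} [Fintype ι] [DecidableEq ι]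
    {t : ι → ℝ} (ht : t ∈ stdSimplex ℝ ι) {i : ι} (hne : t ≠ Pi.single i 1) : t i < 1 := by
  have hsum := Finset.add_sum_erase Finset.univ t (Finset.mem_univ i)
  rw [ht.2] at hsum
  have hnonneg : ∀ j ∈ Finset.univ.erase i, 0 ≤ t j := fun j _ => ht.1 j
  refine lt_of_le_of_ne (by linarith [Finset.sum_nonneg hnonneg]) fun hi => hne ?_
  have hzero := (Finset.sum_eq_zero_iff_of_nonneg hnonneg).1 (by linarith)
  ext j
  rcases eq_or_ne j i with rfl | hj
  · simpa using hi
  · simpa [hj] using hzero j (Finset.mem_erase.2 ⟨hj, Finset.mem_univ j⟩)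

theorem statement8 (m : ℕ) (h : ℝ → ℝ) (hconv : StrictConvexOn ℝ (Set.Ici 0) h)
    (w : Fin m → ℝ) (hw : ∀ i, 0 < w i)
    (H : (Fin m → ℝ) → ℝ) (hH : ∀ x, H x = ∑ i, w i * h (x i / w i)) :
    ∀ i : Fin m,
      ∀ᶠ t in nhdsWithin (Pi.single i 1) (stdSimplex ℝ (Fin m)),
        t ≠ Pi.single i 1 → H t < H (Pi.single i 1) := by
  intro i
  have hc : 0 < 1 / w i := one_div_pos.2 (hw i)
  have hpos : ∀ᶠ t : Fin m → ℝ in nhds (Pi.single i 1), 0 < t i :=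
    (continuous_apply i).continuousAt.eventually (lt_mem_nhds (by simp))
  have hsmall : ∀ᶠ t : Fin m → ℝ in nhds (Pi.single i 1), ∀ j, j ≠ i → t j < 1 / w i * w j := by
    refine eventually_all.2 fun j => ?_
    by_cases hj : j = i
    · simp [hj]
    · have hlim : (Pi.single i 1 : Fin m → ℝ) j < 1 / w i * w j := by
        rw [Pi.single_eq_of_ne hj]
        exact mul_pos hc (hw j)
      filter_upwards [(continuous_apply j).continuousAt.eventually (gt_mem_nhds hlim)]
        with t ht _ using ht
  filter_upwards [self_mem_nhdsWithin, nhdsWithin_le_nhds hpos, nhdsWithin_le_nhds hsmall]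
    with t ht hti htj hne
  have hlt := stdSimplex.apply_lt_one_of_ne_single ht hne
  set c := 1 / w i with hc_def
  set σ := (h c - h 0) / c with hσ
  have chord_sum : ∀ s ∈ stdSimplex ℝ (Fin m),
      ∑ j, w j * (h 0 + σ * (s j / w j)) = (∑ j, w j) * h 0 + σ := by
    intro s hs
    have hterm : ∀ j, w j * (h 0 + σ * (s j / w j)) = w j * h 0 + σ * s j := fun j => by
      have := (hw j).ne'
      field_simp
    simp only [hterm, Finset.sum_add_distrib, ← Finset.sum_mul, ← Finset.mul_sum, hs.2, mul_one]
  have hvertex : H (Pi.single i 1) = (∑ j, w j) * h 0 + σ := by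
    rw [hH, ← chord_sum _ (single_mem_stdSimplex ℝ i)]
    refine Finset.sum_congr rfl fun j _ => ?_
    rcases eq_or_ne j i with rfl | hj
    · rw [Pi.single_eq_same, ← hc_def, hσ, div_mul_cancel₀ _ hc.ne', add_sub_cancel]
    · simp [hj]
  have hi : h (t i / w i) < h 0 + σ * (t i / w i) :=
    hconv.lt_chord_of_mem_Ioo ⟨div_pos hti (hw i), div_lt_div_of_pos_right hlt (hw i)⟩
  rw [hvertex, ← chord_sum t ht, hH]
  refine Finset.sum_lt_sum (fun j _ => ?_)
    ⟨i, Finset.mem_univ i, mul_lt_mul_of_pos_left hi (hw i)⟩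
  refine mul_le_mul_of_nonneg_left ?_ (hw j).le
  rcases eq_or_ne j i with rfl | hj
  · exact hi.le
  · exact hconv.convexOn.le_chord_of_mem_Icc hc
      ⟨div_nonneg (ht.1 j) (hw j).le, ((div_lt_iff₀ (hw j)).2 (htj j hj)).le⟩
end
end

section
/- Let g : [0,∞) → ℝ be such that t ↦ g(√t) is strictly convex on [0,∞), let w₁,…,w_m > 0, and let F : ℝ^m → ℝ be given by F(u) = Σ_{i=1}^m w_i · g(|u_i| / √(w_i)). Then each of the 2m signed canonical basis vectors ±e_i, 1 ≤ i ≤ m, is a strict local maximum of F relative to the unit sphere S^{m−1}. -/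
open Filter Set Metric

noncomputable section

/-- A strictly convex function on `[0, ∞)` lies below the line through its values at `0` and `y`
on `[0, y]`, and strictly above that line beyond `y`. -/
theorem StrictConvexOn.exists_slope_le_lt {h : ℝ → ℝ} (hh : StrictConvexOn ℝ (Ici 0) h)
    {y c : ℝ} (hy : 0 < y) (hyc : y < c) :
    ∃ τ, (∀ x, 0 ≤ x → x ≤ y → h x ≤ h 0 + τ * x) ∧ h 0 + τ * c < h c := by
  refine ⟨(h y - h 0) / y, fun x hx hxy => ?_, ?_⟩
  · have key := hh.convexOn.2 (self_mem_Ici (a := (0 : ℝ))) (mem_Ici.2 hy.le)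
      (sub_nonneg.2 ((div_le_one hy).2 hxy)) (div_nonneg hx hy.le) (sub_add_cancel 1 (x / y))
    simp only [smul_eq_mul, mul_zero, zero_add, div_mul_cancel₀ x hy.ne'] at key
    calc h x ≤ _ := key
      _ = _ := by field_simp; ring
  · have hc : 0 < c := hy.trans hyc
    have key := hh.2 (self_mem_Ici (a := (0 : ℝ))) (mem_Ici.2 hc.le) hc.ne
      (sub_pos.2 ((div_lt_one hc).2 hyc)) (div_pos hy hc) (sub_add_cancel 1 (y / c))
    simp only [smul_eq_mul, mul_zero, zero_add, div_mul_cancel₀ y hc.ne'] at key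
    have hmul := mul_lt_mul_of_pos_right key (div_pos hc hy)
    have hr : ((1 - y / c) * h 0 + y / c * h c) * (c / y) = (c / y - 1) * h 0 + h c := by
      field_simp
    have hl : (h y - h 0) / y * c = h y * (c / y) - h 0 * (c / y) := by ring
    rw [hr] at hmul
    linarith

/-- A unit vector other than `s • eᵢ`, `s = ±1`, whose `i`-th coordinate has the sign of `s`, has
`i`-th coordinate of absolute value less than one. -/
theorem EuclideanSpace.sq_apply_lt_one {ι : Type*} [Fintype ι] [DecidableEq ι]
    {v : EuclideanSpace ℝ ι} (hv : ∑ j, v j ^ 2 = 1) {i : ι} {s : ℝ} (hs : s ^ 2 = 1)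
    (hpos : 0 < s * v i) (hne : v ≠ s • EuclideanSpace.single i 1) : v i ^ 2 < 1 := by
  by_contra! hge
  have hsplit := Finset.add_sum_erase Finset.univ (fun j => v j ^ 2) (Finset.mem_univ i)
  have hnonneg : ∀ j ∈ Finset.univ.erase i, 0 ≤ v j ^ 2 := fun j _ => sq_nonneg _
  have hzero : ∑ j ∈ Finset.univ.erase i, v j ^ 2 = 0 :=
    le_antisymm (by linarith) (Finset.sum_nonneg hnonneg)
  have hi : v i = s := by
    have hsq : v i ^ 2 = s ^ 2 := by linarith
    rcases sq_eq_sq_iff_eq_or_eq_neg.1 hsq with h | h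
    · exact h
    · rw [h] at hpos
      nlinarith
  apply hne
  ext j
  by_cases hj : j = i
  · subst hj
    simp [hi]
  · have := (Finset.sum_eq_zero_iff_of_nonneg hnonneg).1 hzero j (by simp [hj])
    simp [hj, pow_eq_zero_iff two_ne_zero |>.1 this]

theorem statement9 (m : ℕ) (g : ℝ → ℝ)
    (hconv : StrictConvexOn ℝ (Set.Ici 0) (fun t => g (Real.sqrt t)))
    (w : Fin m → ℝ) (hw : ∀ i, 0 < w i)
    (F : EuclideanSpace ℝ (Fin m) → ℝ)
    (hF : ∀ u, F u = ∑ i, w i * g (|u i| / Real.sqrt (w i))) :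
    ∀ i : Fin m, ∀ s : ℝ, (s = 1 ∨ s = -1) →
      ∀ᶠ v in nhdsWithin (s • EuclideanSpace.single i 1)
          (sphere (0 : EuclideanSpace ℝ (Fin m)) 1),
        v ≠ s • EuclideanSpace.single i 1 → F v < F (s • EuclideanSpace.single i 1) := by
  intro i s hs
  have hs2 : s ^ 2 = 1 := by rcases hs with rfl | rfl <;> norm_num
  set h : ℝ → ℝ := fun t => g (Real.sqrt t) with hh
  have hFh : ∀ u, F u = ∑ j, w j * h (u j ^ 2 / w j) := fun u => by
    simp only [hF, hh, Real.sqrt_div (sq_nonneg _), Real.sqrt_sq_eq_abs]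
  set p : EuclideanSpace ℝ (Fin m) := s • EuclideanSpace.single i 1 with hp
  have hpi : p i = s := by simp [hp]
  have hpj : ∀ j, j ≠ i → p j = 0 := fun j hj => by simp [hp, hj]
  have hsign : ∀ᶠ v in nhdsWithin p (sphere 0 1), 0 < s * v i := by
    refine eventually_nhdsWithin_of_eventually_nhds
      (ContinuousAt.eventually_lt (f := fun _ => (0 : ℝ)) (by fun_prop) (by fun_prop) ?_)
    rw [hpi]
    nlinarith
  have hdom : ∀ᶠ v in nhdsWithin p (sphere 0 1), ∀ j, v j ^ 2 / w j ≤ v i ^ 2 / w i := by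
    refine eventually_all.2 fun j => eventually_nhdsWithin_of_eventually_nhds ?_
    by_cases hj : j = i
    · simp [hj]
    · refine (ContinuousAt.eventually_lt (f := fun v : EuclideanSpace ℝ (Fin m) => v j ^ 2 / w j)
        (by fun_prop) (by fun_prop) ?_).mono fun v hv => hv.le
      simpa [hpi, hpj j hj, hs2] using hw i
  filter_upwards [hsign, hdom, self_mem_nhdsWithin] with v hvi hvj hv hne
  have hsum : ∑ j, v j ^ 2 = 1 := by
    rw [← EuclideanSpace.real_norm_sq_eq, mem_sphere_zero_iff_norm.1 hv, one_pow]
  have hvi0 : v i ≠ 0 := right_ne_zero_of_mul hvi.ne'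
  have hlt := EuclideanSpace.sq_apply_lt_one hsum hs2 hvi hne
  obtain ⟨τ, hle, hgt⟩ := hconv.exists_slope_le_lt
    (div_pos (pow_pos (abs_pos.2 hvi0) 2 |>.trans_eq (sq_abs _)) (hw i))
    (div_lt_div_of_pos_right hlt (hw i))
  have hFv : F v ≤ (∑ j, w j) * h 0 + τ := by
    calc F v = ∑ j, w j * h (v j ^ 2 / w j) := hFh v
      _ ≤ ∑ j, (w j * h 0 + τ * v j ^ 2) := by
          refine Finset.sum_le_sum fun j _ => ?_
          have hwj := hw j
          calc w j * h (v j ^ 2 / w j) ≤ w j * (h 0 + τ * (v j ^ 2 / w j)) :=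
                mul_le_mul_of_nonneg_left (hle _ (by positivity) (hvj j)) hwj.le
            _ = w j * h 0 + τ * v j ^ 2 := by field_simp
      _ = (∑ j, w j) * h 0 + τ := by
          rw [Finset.sum_add_distrib, ← Finset.sum_mul, ← Finset.mul_sum, hsum, mul_one]
  have hFp : F p = (∑ j ∈ Finset.univ.erase i, w j) * h 0 + w i * h (1 / w i) := by
    rw [hFh, ← Finset.sum_erase_add _ _ (Finset.mem_univ i), hpi, hs2, Finset.sum_mul]
    congr 1
    refine Finset.sum_congr rfl fun j hj => ?_
    rw [hpj j (Finset.ne_of_mem_erase hj)]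
    simp
  have hwi := hw i
  calc F v ≤ (∑ j, w j) * h 0 + τ := hFv
    _ = (∑ j ∈ Finset.univ.erase i, w j) * h 0 + w i * (h 0 + τ * (1 / w i)) := by
        rw [← Finset.sum_erase_add _ _ (Finset.mem_univ i)]
        field_simp
        ring
    _ < F p := by
        rw [hFp]
        gcongr
end
end

section
/- Let h : [0,∞) → ℝ be a strictly convex function whose right derivative at 0 (an element of [−∞,∞)) equals 0 or −∞, and let α₁,…,α_m and β₁,…,β_m be strictly positive real numbers. Define H : Δ^{m−1} → ℝ by H(t) = Σ_{i=1}^m α_i · h(β_i² · t_i). Then each canonical basis vector e_i, 1 ≤ i ≤ m, is a local maximum of H relative to Δ^{m−1}. -/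
open Filter Set Metric

noncomputable section

/-- If the right derivative of a strictly convex `h` at `0` is `0` or `-∞`, then the difference
quotients at `0` are eventually below any positive multiple of an increment `h b - h 0`. -/
theorem StrictConvexOn.eventually_slope_zero_le {h : ℝ → ℝ}
    (hconv : StrictConvexOn ℝ (Set.Ici 0) h)
    (hderiv : Tendsto (fun x => (h x - h 0) / x) (nhdsWithin 0 (Set.Ioi 0)) (nhds 0) ∨
              Tendsto (fun x => (h x - h 0) / x) (nhdsWithin 0 (Set.Ioi 0)) atBot)
    {b k : ℝ} (hb : 0 < b) (hk : 0 < k) :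
    ∀ᶠ x in nhdsWithin 0 (Set.Ioi 0), (h x - h 0) / x ≤ k * (h b - h 0) := by
  rcases hderiv with h0 | hbot
  · have slope_lt : ∀ x y : ℝ, 0 < x → x < y → (h x - h 0) / x < (h y - h 0) / y := by
      intro x y hx hxy
      have := hconv.secant_strict_mono (a := 0) (x := x) (y := y) self_mem_Ici hx.le
        (hx.trans hxy).le hx.ne' (hx.trans hxy).ne' hxy
      simpa using this
    have half_nonneg : 0 ≤ (h (b / 2) - h 0) / (b / 2) := by
      refine le_of_tendsto h0 ?_
      filter_upwards [Ioo_mem_nhdsGT (half_pos hb)] with x hx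
      exact (slope_lt x (b / 2) hx.1 hx.2).le
    have hpos : 0 < h b - h 0 := by
      have := half_nonneg.trans_lt (slope_lt (b / 2) b (half_pos hb) (half_lt_self hb))
      exact (div_pos_iff_of_pos_right hb).1 this
    exact h0.eventually_le_const (mul_pos hk hpos)
  · exact hbot.eventually_le_atBot _

theorem statement10 (m : ℕ) (h : ℝ → ℝ) (hconv : StrictConvexOn ℝ (Set.Ici 0) h)
    (hderiv : Tendsto (fun x => (h x - h 0) / x) (nhdsWithin 0 (Set.Ioi 0)) (nhds 0) ∨
              Tendsto (fun x => (h x - h 0) / x) (nhdsWithin 0 (Set.Ioi 0)) atBot)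
    (α β : Fin m → ℝ) (hα : ∀ i, 0 < α i) (hβ : ∀ i, 0 < β i)
    (H : (Fin m → ℝ) → ℝ) (hH : ∀ t, H t = ∑ i, α i * h (β i ^ 2 * t i)) :
    ∀ i : Fin m, IsLocalMaxOn H (stdSimplex ℝ (Fin m)) (Pi.single i 1) := by
  intro i
  have hvertex : H (Pi.single i 1) = ∑ j, α j * h 0 + α i * (h (β i ^ 2) - h 0) := by
    rw [hH, ← sub_eq_iff_eq_add', ← Finset.sum_sub_distrib, Finset.sum_eq_single i]
    · simp [mul_sub]
    · intro j _ hj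
      simp [Pi.single_eq_of_ne hj]
    · simp
  have hcoord : ∀ j, ∀ᶠ t in nhdsWithin (Pi.single i 1) (stdSimplex ℝ (Fin m)),
      α j * h (β j ^ 2 * t j) ≤ α j * h 0 + t j * (α i * (h (β i ^ 2) - h 0)) := by
    intro j
    by_cases hj : j = i
    · subst hj
      filter_upwards [self_mem_nhdsWithin] with t ht
      have hle : t j ≤ 1 := ht.2 ▸ Finset.single_le_sum (fun l _ => ht.1 l) (Finset.mem_univ j)
      have hcomb := hconv.convexOn.2 (x := β j ^ 2) (y := 0) (sq_nonneg (β j)) self_mem_Ici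
        (ht.1 j) (sub_nonneg.2 hle) (by ring)
      simp only [smul_eq_mul, mul_zero, add_zero] at hcomb
      rw [mul_comm (t j)] at hcomb
      have := mul_le_mul_of_nonneg_left hcomb (hα j).le
      linarith
    · have hk : 0 < α i / (α j * β j ^ 2) :=
        div_pos (hα i) (mul_pos (hα j) (pow_pos (hβ j) 2))
      have hslope := hconv.eventually_slope_zero_le hderiv (pow_pos (hβ i) 2) hk
      rw [eventually_nhdsWithin_iff] at hslope
      have hlim : Tendsto (fun t : Fin m → ℝ => β j ^ 2 * t j)
          (nhdsWithin (Pi.single i 1) (stdSimplex ℝ (Fin m))) (nhds 0) := by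
        have hcont : Continuous fun t : Fin m → ℝ => β j ^ 2 * t j := by fun_prop
        have := hcont.tendsto (Pi.single i 1)
        simp only [Pi.single_eq_of_ne hj, mul_zero] at this
        exact this.mono_left nhdsWithin_le_nhds
      filter_upwards [hlim.eventually hslope, self_mem_nhdsWithin] with t hts ht
      rcases (ht.1 j).eq_or_lt with h0 | hpos
      · simp [← h0]
      · have hβj := pow_pos (hβ j) 2
        have hαj := hα j
        have hquot := hts (mul_pos hβj hpos)
        rw [div_le_iff₀ (mul_pos hβj hpos)] at hquot
        have hscaled := mul_le_mul_of_nonneg_left hquot hαj.le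
        have hcancel : α j * (α i / (α j * β j ^ 2) * (h (β i ^ 2) - h 0) * (β j ^ 2 * t j))
            = t j * (α i * (h (β i ^ 2) - h 0)) := by
          have := hβ j
          field_simp
        linarith
  filter_upwards [eventually_all.2 hcoord, self_mem_nhdsWithin] with t hbound ht
  rw [hvertex, hH]
  refine (Finset.sum_le_sum fun j _ => hbound j).trans_eq ?_
  rw [Finset.sum_add_distrib, ← Finset.sum_mul _ t, ht.2, one_mul]
end
end

section
/- Let g : [0,∞) → ℝ be continuous, let t₀ > 0, and suppose the map t ↦ g(√t) is twice continuously differentiable on a neighborhood of t₀ with second derivative at t₀ strictly negative. Set v = w = 1/(2t₀) and define F : ℝ² → ℝ by F(x,y) = v · g(|x|/√v) + w · g(|y|/√w). Then the point (1/√2, 1/√2) is a strict local maximum of F relative to the unit circle S¹, and it does not belong to {±e₁, ±e₂}. -/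
open Filter Set Metric

noncomputable section

/-- A function which is `C²` near `a` with negative second derivative at `a` is strictly concave
on a ball around `a`. -/
theorem exists_strictConcaveOn_ball_of_deriv2_neg {h : ℝ → ℝ} {a : ℝ} {s : Set ℝ}
    (hs : IsOpen s) (ha : a ∈ s) (hh : ContDiffOn ℝ 2 h s) (hneg : deriv (deriv h) a < 0) :
    ∃ δ > 0, StrictConcaveOn ℝ (ball a δ) h := by
  have hderiv : ContDiffOn ℝ 1 (deriv h) s := hh.deriv_of_isOpen hs (by norm_num)
  have hcont : ContinuousAt (deriv (deriv h)) a :=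
    (hderiv.continuousOn_deriv_of_isOpen hs le_rfl).continuousAt (hs.mem_nhds ha)
  obtain ⟨δ, hδ, hball⟩ := Metric.eventually_nhds_iff_ball.1
    ((hcont.eventually_lt_const hneg).and (hs.mem_nhds ha))
  refine ⟨δ, hδ, strictConcaveOn_of_deriv2_neg (convex_ball a δ)
    (hh.continuousOn.mono fun x hx => (hball x hx).2) fun x hx => ?_⟩
  exact (hball x (interior_subset hx)).1

theorem statement11 (g : ℝ → ℝ) (hg : ContinuousOn g (Set.Ici 0))
    (t₀ : ℝ) (ht₀ : 0 < t₀)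
    (hsmooth : ∃ ε > 0, ContDiffOn ℝ 2 (fun t => g (Real.sqrt t)) (Set.Ioo (t₀ - ε) (t₀ + ε)))
    (hneg : deriv (deriv (fun t => g (Real.sqrt t))) t₀ < 0)
    (v w : ℝ) (hv : v = 1 / (2 * t₀)) (hw : w = 1 / (2 * t₀))
    (F : EuclideanSpace ℝ (Fin 2) → ℝ)
    (hF : ∀ u, F u = v * g (|u 0| / Real.sqrt v) + w * g (|u 1| / Real.sqrt w))
    (p : EuclideanSpace ℝ (Fin 2)) (hp : ∀ i, p i = 1 / Real.sqrt 2) :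
    (∀ᶠ q in nhdsWithin p (sphere (0 : EuclideanSpace ℝ (Fin 2)) 1),
        q ≠ p → F q < F p) ∧
    (∀ i : Fin 2, p ≠ EuclideanSpace.single i 1 ∧ p ≠ -EuclideanSpace.single i 1) := by
  have hvw : w = v := hw.trans hv.symm
  subst hvw
  obtain ⟨ε, hε, hsm⟩ := hsmooth
  obtain ⟨δ, hδ, hconc⟩ := exists_strictConcaveOn_ball_of_deriv2_neg isOpen_Ioo
    (show t₀ ∈ Set.Ioo (t₀ - ε) (t₀ + ε) by constructor <;> linarith) hsm hneg
  have hw0 : 0 < w := by rw [hw]; positivity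
  have hp0 : ∀ i, 0 < p i := fun i => by rw [hp]; positivity
  have hp2 : ∀ i, p i ^ 2 = 1 / 2 := fun i => by
    rw [hp, div_pow, Real.sq_sqrt zero_le_two, one_pow]
  have harg : ∀ x : ℝ, |x| / √w = √(2 * t₀ * x ^ 2) := fun x => by
    rw [← Real.sqrt_sq_eq_abs, ← Real.sqrt_div (sq_nonneg x), hw]
    congr 1
    field_simp
  have hFp : F p = w * (2 * g √t₀) := by
    rw [hF, harg, harg, hp2, hp2, show 2 * t₀ * (1 / 2) = t₀ by ring]
    ring
  constructor
  · have hnear : ∀ i : Fin 2, ∀ᶠ q in nhds p, 0 < q i ∧ 2 * t₀ * q i ^ 2 ∈ ball t₀ δ := by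
      intro i
      have hc : ContinuousAt (fun q : EuclideanSpace ℝ (Fin 2) => q i) p := by fun_prop
      have hc' : ContinuousAt (fun q : EuclideanSpace ℝ (Fin 2) => 2 * t₀ * q i ^ 2) p := by
        fun_prop
      refine (hc.eventually_const_lt (hp0 i)).and (hc'.eventually_mem ?_)
      rw [hp2, show 2 * t₀ * (1 / 2) = t₀ by ring]
      exact ball_mem_nhds t₀ hδ
    filter_upwards [nhdsWithin_le_nhds (hnear 0), nhdsWithin_le_nhds (hnear 1),
      self_mem_nhdsWithin] with q ⟨hx, hxb⟩ ⟨hy, hyb⟩ hq hqp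
    have hsum : q 0 ^ 2 + q 1 ^ 2 = 1 := by
      have := EuclideanSpace.real_norm_sq_eq q
      rw [mem_sphere_zero_iff_norm.1 hq, Fin.sum_univ_two] at this
      linarith
    have hne : 2 * t₀ * q 0 ^ 2 ≠ 2 * t₀ * q 1 ^ 2 := by
      intro heq
      have hsq : q 0 ^ 2 = q 1 ^ 2 := mul_left_cancel₀ (by positivity) heq
      refine hqp (PiLp.ext fun i => (pow_left_inj₀ ?_ (hp0 i).le two_ne_zero).1 ?_)
      · fin_cases i <;> simp [hx.le, hy.le]
      · rw [hp2]
        fin_cases i <;> simp <;> linarith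
    have hlt := hconc.2 hxb hyb hne one_half_pos one_half_pos (add_halves 1)
    have hmid : (1 / 2 : ℝ) • (2 * t₀ * q 0 ^ 2) + (1 / 2 : ℝ) • (2 * t₀ * q 1 ^ 2) = t₀ := by
      simp only [smul_eq_mul]
      linear_combination t₀ * hsum
    rw [hmid] at hlt
    simp only [smul_eq_mul] at hlt
    rw [hFp, hF, harg, harg, ← mul_add]
    exact mul_lt_mul_of_pos_left (by linarith) hw0
  · refine fun i => ⟨fun h => ?_, fun h => ?_⟩
    all_goals
      have := hp2 i
      rw [h] at this
      norm_num at this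
end
end

section
/- Let g : [0,∞) → ℝ be continuous, let 0 < a < b, and suppose the map t ↦ g(√t) is twice continuously differentiable on (a,b) but is not strictly convex on (a,b). Then there exist weights v, w > 0 such that the function F(x,y) = v · g(|x|/√v) + w · g(|y|/√w) has a local maximum relative to the unit circle S¹ that is not contained in {±e₁, ±e₂}. -/
open Filter Set Metric

noncomputable section

/-- A continuous function on an open interval that is not strictly convex touches some affine
function from below at an interior point. -/
theorem exists_eventually_le_affine_of_not_strictConvexOn {h : ℝ → ℝ} {a b : ℝ}
    (hc : ContinuousOn h (Ioo a b)) (hn : ¬ StrictConvexOn ℝ (Ioo a b) h) :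
    ∃ c ∈ Ioo a b, ∃ m : ℝ, ∀ᶠ t in nhds c, h t ≤ h c + m * (t - c) := by
  obtain ⟨x, hx, y, hy, hxy, p, q, hp, hq, hpq, hle⟩ : ∃ x ∈ Ioo a b, ∃ y ∈ Ioo a b, x < y ∧
      ∃ p q : ℝ, 0 < p ∧ 0 < q ∧ p + q = 1 ∧ p * h x + q * h y ≤ h (p * x + q * y) := by
    by_contra! hcon
    refine hn (LinearOrder.strictConvexOn_of_lt (convex_Ioo a b) ?_)
    intro x hx y hy hxy p q hp hq hpq
    exact hcon x hx y hy hxy p q hp hq hpq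
  have hsub : Icc x y ⊆ Ioo a b := Icc_subset_Ioo hx.1 hy.2
  obtain ⟨m, hm⟩ : ∃ m : ℝ, h y - h x = m * (y - x) :=
    ⟨(h y - h x) / (y - x), by rw [div_mul_cancel₀]; linarith⟩
  obtain ⟨c, hcI, hmax⟩ : ∃ c ∈ Ioo x y, ∀ t ∈ Icc x y, h t - m * t ≤ h c - m * c := by
    obtain ⟨c, hcI, hmax⟩ := isCompact_Icc.exists_isMaxOn (nonempty_Icc.2 hxy.le)
      (f := fun t => h t - m * t) ((hc.mono hsub).sub (by fun_prop))
    rw [isMaxOn_iff] at hmax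
    by_cases hci : c ∈ Ioo x y
    · exact ⟨c, hci, hmax⟩
    · have hend : h c - m * c = h x - m * x := by
        rcases eq_endpoints_or_mem_Ioo_of_mem_Icc hcI with rfl | rfl | h'
        · rfl
        · linarith
        · exact absurd h' hci
      obtain rfl : p = 1 - q := by linarith
      refine ⟨(1 - q) * x + q * y, ⟨by nlinarith, by nlinarith⟩, fun t ht => ?_⟩
      have h1 := hmax t ht
      have h2 : q * (h y - h x) = q * (m * (y - x)) := by rw [hm]
      linarith
  refine ⟨c, hsub (Ioo_subset_Icc_self hcI), m, ?_⟩
  filter_upwards [Ioo_mem_nhds hcI.1 hcI.2] with t ht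
  linarith [hmax t (Ioo_subset_Icc_self ht)]

theorem abs_div_sqrt_eq_sqrt (r : ℝ) {c : ℝ} (hc : 0 < c) :
    |r| / √(1 / (2 * c)) = √(2 * c * r ^ 2) := by
  rw [← Real.sqrt_sq_eq_abs, ← Real.sqrt_div (sq_nonneg r)]
  congr 1
  field_simp

theorem statement12 (g : ℝ → ℝ) (hg : ContinuousOn g (Set.Ici 0))
    (a b : ℝ) (ha : 0 < a) (hab : a < b)
    (hsmooth : ContDiffOn ℝ 2 (fun t => g (Real.sqrt t)) (Set.Ioo a b))
    (hnconv : ¬ StrictConvexOn ℝ (Set.Ioo a b) (fun t => g (Real.sqrt t))) :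
    ∃ v w : ℝ, 0 < v ∧ 0 < w ∧
      ∃ u ∈ sphere (0 : EuclideanSpace ℝ (Fin 2)) 1,
        IsLocalMaxOn (fun q : EuclideanSpace ℝ (Fin 2) =>
            v * g (|q 0| / Real.sqrt v) + w * g (|q 1| / Real.sqrt w))
          (sphere (0 : EuclideanSpace ℝ (Fin 2)) 1) u ∧
        ∀ i : Fin 2, u ≠ EuclideanSpace.single i 1 ∧ u ≠ -EuclideanSpace.single i 1 := by
  obtain ⟨c, hcI, m, hm⟩ :=
    exists_eventually_le_affine_of_not_strictConvexOn hsmooth.continuousOn hnconv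
  have hc : 0 < c := ha.trans hcI.1
  have hv : 0 < 1 / (2 * c) := by positivity
  have hs : (√(1 / 2)) ^ 2 = (1 / 2 : ℝ) := Real.sq_sqrt (by norm_num)
  have hsphere : ∀ q : EuclideanSpace ℝ (Fin 2),
      q ∈ sphere (0 : EuclideanSpace ℝ (Fin 2)) 1 ↔ q 0 ^ 2 + q 1 ^ 2 = 1 := by
    intro q
    rw [mem_sphere_zero_iff_norm, EuclideanSpace.norm_eq, Real.sqrt_eq_one]
    simp [Fin.sum_univ_two]
  refine ⟨_, _, hv, hv, !₂[√(1 / 2), √(1 / 2)], ?_, ?_, ?_⟩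
  · rw [hsphere]
    simp only [Matrix.cons_val_zero, Matrix.cons_val_one, hs]
    norm_num
  · have hcc : 2 * c * √(1 / 2) ^ 2 = c := by rw [hs]; ring
    have hnear : ∀ i : Fin 2, ∀ᶠ q in nhdsWithin (!₂[√(1 / 2), √(1 / 2)])
        (sphere (0 : EuclideanSpace ℝ (Fin 2)) 1),
        g √(2 * c * q i ^ 2) ≤ g √c + m * (2 * c * q i ^ 2 - c) := by
      intro i
      have hcont : Continuous fun q : EuclideanSpace ℝ (Fin 2) => 2 * c * q i ^ 2 := by
        fun_prop
      have ht := hcont.tendsto !₂[√(1 / 2), √(1 / 2)]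
      have hi : 2 * c * (!₂[√(1 / 2), √(1 / 2)] : EuclideanSpace ℝ (Fin 2)) i ^ 2 = c := by
        fin_cases i <;> exact hcc
      rw [hi] at ht
      exact (ht.mono_left nhdsWithin_le_nhds).eventually hm
    filter_upwards [hnear 0, hnear 1, self_mem_nhdsWithin] with q h0 h1 hq
    rw [hsphere] at hq
    simp only [abs_div_sqrt_eq_sqrt _ hc, Matrix.cons_val_zero,
      Matrix.cons_val_one, hcc]
    rw [← mul_add, ← mul_add]
    refine mul_le_mul_of_nonneg_left ?_ hv.le
    have : m * (2 * c * q 0 ^ 2 - c) + m * (2 * c * q 1 ^ 2 - c) = 0 := by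
      linear_combination 2 * m * c * hq
    linarith
  · intro i
    constructor <;> intro h
    all_goals
      have h0 := congrArg (fun q : EuclideanSpace ℝ (Fin 2) => q 0) h
      have h1 := congrArg (fun q : EuclideanSpace ℝ (Fin 2) => q 1) h
      fin_cases i <;> simp at h0 h1
end
end

section
/- Let h : [0,∞) → ℝ be a strictly convex function whose right derivative at 0 is finite and nonzero, and let m ≥ 2 be an integer. Then there exist strictly positive real numbers α₁,…,α_m and β₁,…,β_m such that the function H : Δ^{m−1} → ℝ given by H(t) = Σ_{i=1}^m α_i · h(β_i² · t_i) does not have a local maximum relative to Δ^{m−1} at the vertex e₁. -/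
open Filter Set Metric

noncomputable section

/-- A convex function on `[0, ∞)` lies above its right tangent line at `0`. -/
theorem ConvexOn.add_mul_le_of_tendsto_slope_zero {h : ℝ → ℝ} (hconv : ConvexOn ℝ (Set.Ici 0) h)
    {L : ℝ}
    (hderiv : Tendsto (fun x => (h x - h 0) / x) (nhdsWithin 0 (Set.Ioi 0)) (nhds L))
    {x : ℝ} (hx : 0 < x) : h 0 + L * x ≤ h x := by
  have hle : L ≤ (h x - h 0) / x := by
    refine le_of_tendsto hderiv ?_
    filter_upwards [Ioo_mem_nhdsGT hx] with y hy
    simpa using hconv.secant_mono (a := 0) (x := y) (y := x) (by simp) (by simpa using hy.1.le)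
      (by simpa using hx.le) hy.1.ne' hx.ne' hy.2.le
  rw [le_div_iff₀ hx] at hle
  linarith

/-- Points `b < c` and a weight `a > 0` such that `a * L` exceeds `b` times the slope of `h`
between `b` and `c`. -/
theorem exists_mul_slope_lt_mul {h : ℝ → ℝ} {L : ℝ} (hL : L ≠ 0)
    (htangent : ∀ x, 0 < x → h 0 + L * x ≤ h x)
    (hderiv : Tendsto (fun x => (h x - h 0) / x) (nhdsWithin 0 (Set.Ioi 0)) (nhds L)) :
    ∃ a b c : ℝ, 0 < a ∧ 0 < b ∧ b < c ∧ b * ((h c - h b) / (c - b)) < a * L := by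
  rcases hL.lt_or_gt with hneg | hpos
  · obtain ⟨c, hc, hc0⟩ :=
      ((hderiv.eventually_lt_const hneg).and self_mem_nhdsWithin).exists
    have hc0 : 0 < c := hc0
    have hlt : h c - h 0 < 0 := by
      rwa [div_lt_iff₀ hc0, zero_mul] at hc
    obtain ⟨b, hb⟩ : ∃ b, b = (h c - h 0) / (2 * L) := ⟨_, rfl⟩
    have hb0 : 0 < b := hb ▸ div_pos_of_neg_of_neg hlt (by linarith)
    have hbL : b * (2 * L) = h c - h 0 := by
      rw [hb]; field_simp
    have hbc : b < c := by
      have := htangent c hc0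
      nlinarith
    have hK : b * ((h c - h b) / (c - b)) < 0 := by
      have := htangent b hb0
      exact mul_neg_of_pos_of_neg hb0 (div_neg_of_neg_of_pos (by linarith) (by linarith))
    refine ⟨b * ((h c - h b) / (c - b)) / (2 * L), b, c,
      div_pos_of_neg_of_neg hK (by linarith), hb0, hbc, ?_⟩
    generalize b * ((h c - h b) / (c - b)) = K at hK
    have : K / (2 * L) * L = K / 2 := by field_simp
    linarith
  · refine ⟨(|h 2 - h 1| + 1) / L, 1, 2, by positivity, one_pos, one_lt_two, ?_⟩
    rw [div_mul_cancel₀ _ hL]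
    norm_num
    linarith [le_abs_self (h 2 - h 1)]

theorem statement13 (h : ℝ → ℝ) (hconv : StrictConvexOn ℝ (Set.Ici 0) h)
    (L : ℝ) (hL : L ≠ 0)
    (hderiv : Tendsto (fun x => (h x - h 0) / x) (nhdsWithin 0 (Set.Ioi 0)) (nhds L))
    (m : ℕ) (hm : 2 ≤ m) :
    ∃ α β : Fin m → ℝ, (∀ i, 0 < α i) ∧ (∀ i, 0 < β i) ∧
      ¬ IsLocalMaxOn (fun t : Fin m → ℝ => ∑ i, α i * h (β i ^ 2 * t i))
          (stdSimplex ℝ (Fin m)) (Pi.single (⟨0, by omega⟩ : Fin m) 1) := by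
  have htangent : ∀ x, 0 < x → h 0 + L * x ≤ h x := fun x hx =>
    hconv.convexOn.add_mul_le_of_tendsto_slope_zero hderiv hx
  obtain ⟨a, b, c, ha, hb, hbc, habc⟩ := exists_mul_slope_lt_mul hL htangent hderiv
  obtain ⟨n, rfl⟩ : ∃ n, m = n + 2 := ⟨m - 2, by omega⟩
  refine ⟨Fin.cons 1 (Fin.cons a fun _ => 1), Fin.cons (√b) fun _ => 1, ?_, ?_, ?_⟩
  · exact Fin.cases (by simp) (Fin.cases (by simpa using ha) (by simp))
  · exact Fin.cases (by simpa using hb) (by simp)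
  intro hmax
  have hvertex : (Pi.single (⟨0, by omega⟩ : Fin (n + 2)) 1 : Fin (n + 2) → ℝ)
      = Fin.cons 1 (Fin.cons 0 fun _ => 0) := by
    funext i
    refine Fin.cases ?_ (Fin.cases ?_ fun j => ?_) i <;> simp [Fin.ext_iff]
  rw [hvertex] at hmax
  let edge : ℝ → Fin (n + 2) → ℝ := fun s => Fin.cons (1 - s) (Fin.cons s fun _ => 0)
  have hcont : Continuous edge := by
    refine continuous_pi (Fin.cases ?_ (Fin.cases ?_ fun j => ?_)) <;> simp [edge] <;> fun_prop
  have hmem : ∀ s ∈ Ioo (0 : ℝ) 1, edge s ∈ stdSimplex ℝ (Fin (n + 2)) := by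
    intro s hs
    refine ⟨?_, by simp [edge, Fin.sum_univ_succ]⟩
    exact Fin.cases (by simpa [edge] using hs.2.le)
      (Fin.cases (by simpa [edge] using hs.1.le) (by simp [edge]))
  have htendsto : Tendsto edge (nhdsWithin 0 (Ioi 0))
      (nhdsWithin (Fin.cons 1 (Fin.cons 0 fun _ => 0)) (stdSimplex ℝ (Fin (n + 2)))) := by
    refine tendsto_nhdsWithin_iff.2 ⟨?_, ?_⟩
    · have := (hcont.tendsto 0).mono_left (nhdsWithin_le_nhds (s := Ioi 0))
      simpa [edge] using this
    · filter_upwards [Ioo_mem_nhdsGT one_pos] with s hs using hmem s hs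
  obtain ⟨s, hle, hs⟩ := ((htendsto.eventually hmax).and (Ioo_mem_nhdsGT one_pos)).exists
  have hslope := hconv.convexOn.slope_mono_adjacent (x := b * (1 - s)) (y := b) (z := c)
    (mul_nonneg hb.le (by linarith [hs.2])) (hb.le.trans hbc.le) (by nlinarith [hs.1]) hbc
  have hbs : 0 < b * s := mul_pos hb hs.1
  rw [show b - b * (1 - s) = b * s by ring, div_le_iff₀ hbs] at hslope
  have htan := mul_le_mul_of_nonneg_left (htangent s hs.1) ha.le
  have hgain := mul_lt_mul_of_pos_right habc hs.1
  simp [edge, Fin.sum_univ_succ, Real.sq_sqrt hb.le] at hle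
  linarith
end
end

section
/- Let X, X̃ ∈ ℝ^{n×m} be matrices such that the columns of X are pairwise orthogonal each of Euclidean norm √n, and likewise for X̃ (equivalently, (1/√n)X and (1/√n)X̃ have orthonormal columns). Then for every orthogonal matrix R ∈ ℝ^{m×m}, (1/√n)·‖X R − X̃‖ ≤ ‖(I − (1/n)·X Xᵀ)·(1/n)·X̃ X̃ᵀ‖ + ‖R − (1/n)·Xᵀ X̃‖, where ‖·‖ denotes the operator (spectral) norm. -/
open Matrix

noncomputable section

/-- The operator (spectral) norm of a real matrix, viewed as a linear map
between Euclidean spaces. -/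
noncomputable def specNorm {n m : ℕ} (M : Matrix (Fin n) (Fin m) ℝ) : ℝ :=
  ‖LinearMap.toContinuousLinearMap (Matrix.toEuclideanLin M)‖

open scoped Matrix.Norms.L2Operator in
theorem specNorm_eq_l2_opNorm {n m : ℕ} (M : Matrix (Fin n) (Fin m) ℝ) :
    specNorm M = ‖M‖ := (l2_opNorm_def M).symm

open scoped Matrix.Norms.L2Operator in
/-- A matrix whose Gram matrix is `c • 1` has spectral norm at most `√c`. -/
theorem l2_opNorm_le_sqrt_of_transpose_mul_self {n m : ℕ} {c : ℝ} (hc : 0 ≤ c)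
    {X : Matrix (Fin n) (Fin m) ℝ} (hX : Xᵀ * X = c • 1) : ‖X‖ ≤ √c := by
  have hone : ‖(1 : Matrix (Fin m) (Fin m) ℝ)‖ ≤ 1 := by
    rw [← diagonal_one, l2_opNorm_diagonal]
    exact (pi_norm_le_iff_of_nonneg zero_le_one).2 fun _ => by simp
  apply Real.le_sqrt_of_sq_le
  rw [sq, ← l2_opNorm_conjTranspose_mul_self, conjTranspose_eq_transpose_of_trivial, hX,
    norm_smul, Real.norm_of_nonneg hc]
  exact mul_le_of_le_one_right hc hone

open scoped Matrix.Norms.L2Operator in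
theorem statement15 (n m : ℕ) (hn : 0 < n)
    (X Xt : Matrix (Fin n) (Fin m) ℝ)
    (hX : Xᵀ * X = (n : ℝ) • 1) (hXt : Xtᵀ * Xt = (n : ℝ) • 1)
    (R : Matrix (Fin m) (Fin m) ℝ) (hR : Rᵀ * R = 1) :
    (Real.sqrt n)⁻¹ * specNorm (X * R - Xt) ≤
      specNorm ((1 - (n : ℝ)⁻¹ • (X * Xᵀ)) * ((n : ℝ)⁻¹ • (Xt * Xtᵀ))) +
        specNorm (R - (n : ℝ)⁻¹ • (Xᵀ * Xt)) := by
  have hn0 : (n : ℝ) ≠ 0 := by positivity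
  have hs : 0 < √(n : ℝ) := by positivity
  simp only [specNorm_eq_l2_opNorm]
  have hXn := l2_opNorm_le_sqrt_of_transpose_mul_self n.cast_nonneg hX
  have hXtn := l2_opNorm_le_sqrt_of_transpose_mul_self n.cast_nonneg hXt
  set A := (1 - (n : ℝ)⁻¹ • (X * Xᵀ)) * ((n : ℝ)⁻¹ • (Xt * Xtᵀ))
  set B := R - (n : ℝ)⁻¹ • (Xᵀ * Xt)
  have hdecomp : X * R - Xt = X * B - A * Xt := by
    have hproj : ((n : ℝ)⁻¹ • (Xt * Xtᵀ)) * Xt = Xt := by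
      rw [Matrix.smul_mul, Matrix.mul_assoc, hXt, Matrix.mul_smul, Matrix.mul_one, smul_smul,
        inv_mul_cancel₀ hn0, one_smul]
    rw [Matrix.mul_assoc, hproj, Matrix.sub_mul, Matrix.mul_sub, Matrix.one_mul,
      Matrix.mul_smul, Matrix.smul_mul, Matrix.mul_assoc]
    abel
  rw [inv_mul_le_iff₀ hs, hdecomp]
  calc ‖X * B - A * Xt‖ ≤ ‖X * B‖ + ‖A * Xt‖ := norm_sub_le _ _
    _ ≤ ‖X‖ * ‖B‖ + ‖A‖ * ‖Xt‖ := add_le_add (l2_opNorm_mul _ _) (l2_opNorm_mul _ _)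
    _ ≤ √n * ‖B‖ + ‖A‖ * √n := by gcongr
    _ = √n * (‖A‖ + ‖B‖) := by ring
end
end
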